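/- Let Z ⊆ ℝ^m with ‖z‖₂ ≤ B for all z ∈ Z, and let w_1,…,w_d ∈ ℝ^m satisfy ‖w_k‖₂ = 1 for each k (e.g., the first d principal components computed from a training set, which maximize ∑_{i=1}^n ∑_{k=1}^d (w_k·s_i)² subject to unit norms and orthogonality). Then for all z_a, z_b ∈ Z, | ∑_{k=1}^d (w_k·z_a)² − ∑_{k=1}^d (w_k·z_b)² | ≤ 2dB·‖z_a − z_b‖₂. Consequently, if Z admits a finite γ/2-cover of cardinality N (with respect to ‖·‖₂), then PCA is (N, 2dγB)-robust: Z can be partitioned into N disjoint sets such that whenever a training sample s_j and a point z lie in a common set, |l((w_1,…,w_d), s_j) − l((w_1,…,w_d), z)| ≤ 2dγB, where l((w_1,…,w_d), z) = ∑_{k=1}^d (w_k·z)². -/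

import Mathlib

open scoped RealInnerProductSpace

/-- For unit vectors `w k`, the map `z ↦ ∑ k, ⟪w k, z⟫ ^ 2` is Lipschitz on balls. -/
theorem abs_sum_inner_sq_sub_le {E ι : Type*} [NormedAddCommGroup E] [InnerProductSpace ℝ E]
    [Fintype ι] {w : ι → E} (hw : ∀ k, ‖w k‖ = 1) {B : ℝ} {x y : E}
    (hx : ‖x‖ ≤ B) (hy : ‖y‖ ≤ B) :
    |(∑ k, ⟪w k, x⟫ ^ 2) - ∑ k, ⟪w k, y⟫ ^ 2| ≤ 2 * Fintype.card ι * B * ‖x - y‖ := by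
  have inner_le (k : ι) (v : E) : |⟪w k, v⟫| ≤ ‖v‖ := by
    simpa [hw k] using abs_real_inner_le_norm (w k) v
  have term_le (k : ι) : |⟪w k, x⟫ ^ 2 - ⟪w k, y⟫ ^ 2| ≤ 2 * B * ‖x - y‖ := by
    rw [sq_sub_sq, ← inner_add_right, ← inner_sub_right, abs_mul]
    have hadd : ‖x + y‖ ≤ 2 * B := (norm_add_le x y).trans (by linarith)
    exact mul_le_mul ((inner_le k _).trans hadd) (inner_le k _) (abs_nonneg _)
      ((norm_nonneg _).trans hadd)
  rw [← Finset.sum_sub_distrib]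
  calc |∑ k, (⟪w k, x⟫ ^ 2 - ⟪w k, y⟫ ^ 2)|
      ≤ ∑ k, |⟪w k, x⟫ ^ 2 - ⟪w k, y⟫ ^ 2| := Finset.abs_sum_le_sum_abs _ _
    _ ≤ ∑ _k : ι, 2 * B * ‖x - y‖ := Finset.sum_le_sum fun k _ => term_le k
    _ = 2 * Fintype.card ι * B * ‖x - y‖ := by
      rw [Finset.sum_const, Finset.card_univ, nsmul_eq_mul]
      ring

/-- A `γ / 2`-cover of `Z` indexed by `ι` yields a partition of `Z` indexed by `ι` into sets of
diameter at most `γ`. -/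
theorem exists_partition_of_cover {E ι : Type*} [SeminormedAddCommGroup E] {Z : Set E} {γ : ℝ}
    {c : ι → E} (hc : ∀ z ∈ Z, ∃ i, ‖z - c i‖ ≤ γ / 2) :
    ∃ D : ι → Set E, Pairwise (Function.onFun Disjoint D) ∧ ⋃ i, D i = Z ∧
      ∀ i, ∀ x ∈ D i, ∀ y ∈ D i, ‖x - y‖ ≤ γ := by
  choose f hf using hc
  refine ⟨fun i => {z | ∃ h : z ∈ Z, f z h = i}, ?_, ?_, ?_⟩
  · intro i j hij
    refine Set.disjoint_left.mpr ?_
    rintro z ⟨_, hi⟩ ⟨_, hj⟩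
    exact hij (hi.symm.trans hj)
  · ext z
    simp
  · rintro i x ⟨hx, rfl⟩ y ⟨hy, hxy⟩
    have hyc := hf y hy
    rw [hxy, norm_sub_rev] at hyc
    linarith [norm_sub_le_norm_sub_add_norm_sub x (c (f x hx)) y, hf x hx]

/-- **Robustness of Principal Component Analysis.**
Let `Z ⊆ ℝᵐ` be bounded by `B` and let `w₁,…,w_d` be unit vectors (e.g. the
first `d` principal components of a training set). Then the PCA loss
`l(z) = ∑_k (w_k·z)²` is `2dB`-Lipschitz on `Z`, and if `Z` admits a finite
`γ/2`-cover of cardinality `N`, then `Z` can be partitioned into `N` disjoint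
sets on which losses of any two points differ by at most `2dγB`. -/
theorem pca_robust
    (m d : ℕ) (B : ℝ)
    (Z : Set (EuclideanSpace ℝ (Fin m))) (hZ : ∀ z ∈ Z, ‖z‖ ≤ B)
    (w : Fin d → EuclideanSpace ℝ (Fin m)) (hw : ∀ k, ‖w k‖ = 1)
    (γ : ℝ) (hγ : 0 < γ)
    (N : ℕ) (cov : Fin N → EuclideanSpace ℝ (Fin m)) (hcovZ : ∀ i, cov i ∈ Z)
    (hcov : ∀ z ∈ Z, ∃ i, ‖z - cov i‖ ≤ γ / 2) :
    (∀ za ∈ Z, ∀ zb ∈ Z,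
      |(∑ k, ⟪w k, za⟫ ^ 2) - ∑ k, ⟪w k, zb⟫ ^ 2|
        ≤ 2 * d * B * ‖za - zb‖) ∧
    ∃ D : Fin N → Set (EuclideanSpace ℝ (Fin m)),
      Pairwise (Function.onFun Disjoint D) ∧
      Z ⊆ ⋃ i, D i ∧
      (∀ z₁ ∈ Z, ∀ z₂ ∈ Z, ∀ i : Fin N, z₁ ∈ D i → z₂ ∈ D i →
        |(∑ k, ⟪w k, z₁⟫ ^ 2) - ∑ k, ⟪w k, z₂⟫ ^ 2|
          ≤ 2 * d * γ * B) := by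
  have lipschitz : ∀ za ∈ Z, ∀ zb ∈ Z,
      |(∑ k, ⟪w k, za⟫ ^ 2) - ∑ k, ⟪w k, zb⟫ ^ 2| ≤ 2 * d * B * ‖za - zb‖ := by
    intro za ha zb hb
    simpa using abs_sum_inner_sq_sub_le hw (hZ za ha) (hZ zb hb)
  obtain ⟨D, hdisj, hunion, hdiam⟩ := exists_partition_of_cover hcov
  refine ⟨lipschitz, D, hdisj, hunion.ge, fun z₁ h₁ z₂ h₂ i hi₁ hi₂ => ?_⟩
  have hB : 0 ≤ B := (norm_nonneg z₁).trans (hZ z₁ h₁)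
  calc |(∑ k, ⟪w k, z₁⟫ ^ 2) - ∑ k, ⟪w k, z₂⟫ ^ 2|
      ≤ 2 * d * B * ‖z₁ - z₂‖ := lipschitz z₁ h₁ z₂ h₂
    _ ≤ 2 * d * B * γ := by
      gcongr
      exact hdiam i z₁ hi₁ z₂ hi₂
    _ = 2 * d * γ * B := by ring
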